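/- Let γ (respectively γ') denote the minimal nonnegative integer divisible by c such that every multiple of c exceeding it admits a general solution with respect to (p_1, …, p_r) (respectively with respect to the reversed tuple (p_r, …, p_1)). Then for every positive integer k with k ≥ (4p − 2p_1 − 2p_r)/c + 1 − r and every integer f divisible by c with γ < f < pk − γ', there exists a general solution for f with respect to (p_1, …, p_r) satisfying the height bound for k. -/

import Mathlib

open Finset

/-- `g = (f_1, …, f_r)` is a *general solution* for `f` with respect to the pile
multiplicities `p = (p_1, …, p_r)`: the entries are strictly increasing nonnegative
integers with `p_1 f_1 + ⋯ + p_r f_r = f`. -/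
def IsGenSol {r : ℕ} (p : Fin r → ℕ) (f : ℕ) (g : Fin r → ℕ) : Prop :=
  StrictMono g ∧ ∑ i, p i * g i = f

/-- A general solution `g` satisfies the *height bound* for `k`: its last entry `f_r`
is at most `k`. -/
def HeightBound {r : ℕ} (hr : 0 < r) (g : Fin r → ℕ) (k : ℕ) : Prop :=
  g ⟨r - 1, Nat.sub_lt hr Nat.one_pos⟩ ≤ k

/-- The sorting strategy is *discreet* for `f` with pile size `k`: there is a general
solution for `f` satisfying the height bound for `k` with `f_1 ≥ 1`, and one with
`f_r ≤ k - 1`. -/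
def Discreet {r : ℕ} (hr : 0 < r) (p : Fin r → ℕ) (f k : ℕ) : Prop :=
  (∃ g, IsGenSol p f g ∧ HeightBound hr g k ∧ 1 ≤ g ⟨0, hr⟩) ∧
  (∃ g, IsGenSol p f g ∧ HeightBound hr g k ∧
    g ⟨r - 1, Nat.sub_lt hr Nat.one_pos⟩ ≤ k - 1)

/-- `F_min = Σ_{i=1}^r (i-1) p_i` (with `0`-based indexing, `Σ_i i · p_i`). -/
def Fmin {r : ℕ} (p : Fin r → ℕ) : ℕ := ∑ i : Fin r, (i : ℕ) * p i

/-- Truncating a monotone function at two levels `B ≤ A` and removing the difference leaves a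
monotone function. -/
theorem Monotone.sub_min_add_min {ι : Type*} [Preorder ι] {D : ι → ℕ} (hD : Monotone D)
    {A B : ℕ} (hBA : B ≤ A) (j : ℕ) :
    Monotone fun i => D i - min (D i) A + min (D i) B + j := by
  intro a b hab
  have := hD hab
  dsimp only
  omega

/-- If the spread of a monotone `D` is at least `∑ i, q i`, then `D` can be replaced by a monotone
function with the same weighted sum and a smaller last value. -/
theorem exists_monotone_last_lt {n : ℕ} {q : Fin (n + 1) → ℕ} (hq : 0 < q 0)
    {D : Fin (n + 1) → ℕ} (hD : Monotone D) (hspread : D 0 + ∑ i, q i ≤ D (Fin.last n)) :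
    ∃ D' : Fin (n + 1) → ℕ, Monotone D' ∧ ∑ i, q i * D' i = ∑ i, q i * D i ∧
      D' (Fin.last n) < D (Fin.last n) := by
  set m := ∑ i, q i with hm
  have hm0 : 0 < m := hq.trans_le (single_le_sum (fun i _ => Nat.zero_le (q i)) (mem_univ 0))
  let φ : ℕ → ℕ := fun v => ∑ i, q i * min (D i) v
  have hφ : Monotone φ := fun u v huv =>
    sum_le_sum fun i _ => Nat.mul_le_mul_left _ (min_le_min_left _ huv)
  obtain ⟨A, B, hBA, hB, hA, hmod⟩ : ∃ A B, B < A ∧ D 0 ≤ B ∧ A ≤ D 0 + m ∧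
      φ B ≡ φ A [MOD m] := by
    obtain ⟨u, hu, v, hv, huv, h⟩ := exists_ne_map_eq_of_card_lt_of_maps_to
      (s := range (m + 1)) (t := range m) (f := fun v => φ (D 0 + v) % m) (by simp)
      (fun v _ => by simpa using Nat.mod_lt _ hm0)
    simp only [mem_range] at hu hv
    rcases huv.lt_or_gt with huv | huv
    · exact ⟨D 0 + v, D 0 + u, by omega, by omega, by omega, h⟩
    · exact ⟨D 0 + u, D 0 + v, by omega, by omega, by omega, h.symm⟩
  obtain ⟨j, hj⟩ := (Nat.modEq_iff_dvd' (hφ hBA.le)).1 hmod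
  have hφj : φ A = φ B + m * j := by have := hφ hBA.le; omega
  have hjlt : j < A - B := by
    have hlt : φ A < φ B + m * (A - B) := by
      simp only [φ, hm, sum_mul, ← sum_add_distrib, ← mul_add]
      refine sum_lt_sum (fun i _ => Nat.mul_le_mul_left _ (by omega)) ⟨0, mem_univ _, ?_⟩
      exact Nat.mul_lt_mul_of_pos_left (by omega) hq
    rw [hφj] at hlt
    exact Nat.lt_of_mul_lt_mul_left (Nat.lt_of_add_lt_add_left hlt)
  refine ⟨_, hD.sub_min_add_min hBA.le j, ?_, by omega⟩
  have hsum : ∑ i, q i * (D i - min (D i) A + min (D i) B + j) + φ A =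
      ∑ i, q i * D i + φ B + m * j := by
    simp only [φ, hm, sum_mul, ← sum_add_distrib, ← mul_add]
    exact sum_congr rfl fun i _ => congrArg _ (by omega)
  omega

/-- Every monotone function can be replaced by one with the same weighted sum whose spread is less
than the sum of the weights. -/
theorem exists_monotone_spread_lt {n : ℕ} {q : Fin (n + 1) → ℕ} (hq : 0 < q 0)
    {D : Fin (n + 1) → ℕ} (hD : Monotone D) :
    ∃ D' : Fin (n + 1) → ℕ, Monotone D' ∧ ∑ i, q i * D' i = ∑ i, q i * D i ∧
      D' (Fin.last n) < D' 0 + ∑ i, q i := by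
  induction h : D (Fin.last n) using Nat.strong_induction_on generalizing D with
  | _ N ih =>
    subst h
    by_cases hs : D (Fin.last n) < D 0 + ∑ i, q i
    · exact ⟨D, hD, rfl, hs⟩
    · obtain ⟨D₁, hD₁, hsum, hlt⟩ := exists_monotone_last_lt hq hD (not_lt.1 hs)
      obtain ⟨D₂, hD₂, hsum₂, hlt₂⟩ := ih _ hlt hD₁ rfl
      exact ⟨D₂, hD₂, hsum₂.trans hsum, hlt₂⟩

theorem sum_mul_zero_le {n : ℕ} (q : Fin (n + 1) → ℕ) {D : Fin (n + 1) → ℕ} (hD : Monotone D) :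
    (∑ i, q i) * D 0 ≤ ∑ i, q i * D i := by
  rw [sum_mul]
  exact sum_le_sum fun i _ => Nat.mul_le_mul_left _ (hD (Fin.zero_le i))

theorem sum_rev_mul {n : ℕ} (q E : Fin n → ℕ) :
    ∑ i, q (Fin.rev i) * E i = ∑ i, q i * E (Fin.rev i) := by
  rw [← Equiv.sum_comp Fin.revPerm]
  simp

/-- A weighted sum attained by a monotone function, whose complement in `(∑ i, q i) * K` is
attained for the reversed weights, is attained by a monotone function bounded by `K`. -/
theorem exists_monotone_last_le {n : ℕ} {q : Fin (n + 1) → ℕ} (hq : ∀ i, 0 < q i)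
    {D E : Fin (n + 1) → ℕ} (hD : Monotone D) (hE : Monotone E) {K : ℕ}
    (hDE : ∑ i, q i * D i + ∑ i, q (Fin.rev i) * E i = (∑ i, q i) * K)
    (hK : 2 * ∑ i, q i ≤ K + 2) :
    ∃ D' : Fin (n + 1) → ℕ, Monotone D' ∧ ∑ i, q i * D' i = ∑ i, q i * D i ∧
      D' (Fin.last n) ≤ K := by
  obtain ⟨D', hD', hDsum, hDs⟩ := exists_monotone_spread_lt (hq 0) hD
  obtain ⟨E', hE', hEsum, hEs⟩ :=
    exists_monotone_spread_lt (q := fun i => q (Fin.rev i)) (hq _) hE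
  have hrev : ∑ i, q (Fin.rev i) = ∑ i, q i := Equiv.sum_comp Fin.revPerm q
  by_cases hDK : D' (Fin.last n) ≤ K
  · exact ⟨D', hD', hDsum, hDK⟩
  by_cases hEK : E' (Fin.last n) ≤ K
  · have hle : ∀ i, E' i ≤ K := fun i => (hE' (Fin.le_last i)).trans hEK
    refine ⟨fun i => K - E' (Fin.rev i),
      fun a b hab => Nat.sub_le_sub_left (hE' (Fin.rev_le_rev.2 hab)) K, ?_, Nat.sub_le _ _⟩
    have hsum : ∑ i, q i * (K - E' (Fin.rev i)) + ∑ i, q i * E' (Fin.rev i) =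
        (∑ i, q i) * K := by
      rw [sum_mul, ← sum_add_distrib]
      refine sum_congr rfl fun i _ => ?_
      rw [← mul_add, Nat.sub_add_cancel (hle _)]
    rw [sum_rev_mul q E'] at hEsum
    dsimp only
    omega
  · exfalso
    have h1 := sum_mul_zero_le q hD'
    have h2 := sum_mul_zero_le (fun i => q (Fin.rev i)) hE'
    simp only [hrev] at h2 hEs
    have hpos : 0 < ∑ i, q i := sum_pos (fun i _ => hq i) univ_nonempty
    have h3 : (∑ i, q i) * (D' 0 + E' 0) ≤ (∑ i, q i) * K := by
      rw [mul_add]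
      omega
    have := Nat.le_of_mul_le_mul_left h3 hpos
    omega

theorem StrictMono.exists_monotone_add_val {n : ℕ} {g : Fin (n + 1) → ℕ} (hg : StrictMono g) :
    ∃ D : Fin (n + 1) → ℕ, Monotone D ∧ ∀ i, g i = D i + i := by
  have hle : ∀ i : Fin (n + 1), (i : ℕ) ≤ g i := by
    intro i
    induction i using Fin.induction with
    | zero => simp
    | succ i ih =>
      have := hg (Fin.castSucc_lt_succ (i := i))
      simp only [Fin.val_castSucc, Fin.val_succ] at ih ⊢
      omega
  refine ⟨fun i => g i - i, Fin.monotone_iff_le_succ.2 fun i => ?_,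
    fun i => (Nat.sub_add_cancel (hle i)).symm⟩
  have := hg (Fin.castSucc_lt_succ (i := i))
  simp only [Fin.val_castSucc, Fin.val_succ]
  omega

theorem Monotone.strictMono_add_val {n : ℕ} {D : Fin n → ℕ} (hD : Monotone D) :
    StrictMono fun i => D i + (i : ℕ) :=
  hD.add_strictMono Fin.val_strictMono

theorem sum_ge_first_add_last {n : ℕ} {q : Fin (n + 2) → ℕ} (hq : ∀ i, 0 < q i) :
    q 0 + q (Fin.last (n + 1)) + n ≤ ∑ i, q i := by
  rw [Fin.sum_univ_succ, Fin.sum_univ_castSucc, Fin.succ_last]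
  have : n ≤ ∑ i : Fin n, q i.castSucc.succ := by
    simpa using card_nsmul_le_sum univ (fun i : Fin n => q i.castSucc.succ) 1 fun i _ => hq _
  simp only [Nat.succ_eq_add_one]
  omega

/-- A sum that has a general solution, and whose complement in `(∑ i, q i) * k` has one for the
reversed weights, has a general solution satisfying the height bound for `k`. -/
theorem exists_strictMono_last_le {n : ℕ} {q : Fin (n + 1) → ℕ} (hq : ∀ i, 0 < q i)
    {g h : Fin (n + 1) → ℕ} (hg : StrictMono g) (hh : StrictMono h) {k : ℕ}
    (hgh : ∑ i, q i * g i + ∑ i, q (Fin.rev i) * h i = (∑ i, q i) * k)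
    (hk : 2 * ∑ i, q i + n ≤ k + 2) :
    ∃ g' : Fin (n + 1) → ℕ, StrictMono g' ∧ ∑ i, q i * g' i = ∑ i, q i * g i ∧
      g' (Fin.last n) ≤ k := by
  obtain ⟨D, hD, hgD⟩ := hg.exists_monotone_add_val
  obtain ⟨E, hE, hhE⟩ := hh.exists_monotone_add_val
  have hpos : 0 < ∑ i, q i := sum_pos (fun i _ => hq i) univ_nonempty
  obtain ⟨K, rfl⟩ : ∃ K, k = K + n := ⟨k - n, by omega⟩
  have hval : ∑ i, q i * (i : ℕ) + ∑ i, q (Fin.rev i) * (i : ℕ) = (∑ i, q i) * n := by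
    rw [sum_rev_mul q fun i => (i : ℕ), sum_mul, ← sum_add_distrib]
    refine sum_congr rfl fun i _ => ?_
    rw [← mul_add, Fin.val_rev]
    congr 1
    omega
  simp only [hgD, hhE, mul_add, sum_add_distrib] at hgh
  obtain ⟨D', hD', hsum, hle⟩ := exists_monotone_last_le hq hD hE (K := K) (by omega) (by omega)
  refine ⟨_, hD'.strictMono_add_val, ?_, by simpa using hle⟩
  simp only [hgD, mul_add, sum_add_distrib, hsum]

/-- With `γ, γ'` minimal as in the previous statements, for every
`k ≥ (4p - 2p_1 - 2p_r)/c + 1 - r` (stated additively) and every `f` divisible by `c`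
with `γ < f < pk - γ'`, there is a general solution for `f` satisfying the height bound
for `k`. -/
theorem arithmetic_progression_range (r : ℕ) (hr : 2 ≤ r) (p : Fin r → ℕ)
    (hp : ∀ i, 0 < p i) (γ γ' : ℕ)
    (hγ : (Finset.univ.gcd p ∣ γ ∧
        ∀ f : ℕ, γ < f → Finset.univ.gcd p ∣ f → ∃ g, IsGenSol p f g) ∧
      ∀ γ₀ : ℕ,
        (Finset.univ.gcd p ∣ γ₀ ∧
          ∀ f : ℕ, γ₀ < f → Finset.univ.gcd p ∣ f → ∃ g, IsGenSol p f g) →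
        γ ≤ γ₀)
    (hγ' : (Finset.univ.gcd p ∣ γ' ∧
        ∀ f : ℕ, γ' < f → Finset.univ.gcd p ∣ f →
          ∃ g, IsGenSol (fun i => p i.rev) f g) ∧
      ∀ γ₀ : ℕ,
        (Finset.univ.gcd p ∣ γ₀ ∧
          ∀ f : ℕ, γ₀ < f → Finset.univ.gcd p ∣ f →
            ∃ g, IsGenSol (fun i => p i.rev) f g) →
        γ' ≤ γ₀)
    (k : ℕ) (hk0 : 0 < k)
    (hk : (4 * (∑ i, p i) - 2 * p ⟨0, by omega⟩ - 2 * p ⟨r - 1, by omega⟩) /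
        Finset.univ.gcd p + 1 ≤ k + r)
    (f : ℕ) (hcf : Finset.univ.gcd p ∣ f) (hγf : γ < f)
    (hfk : f + γ' < (∑ i, p i) * k) :
    ∃ g, IsGenSol p f g ∧ HeightBound (by omega) g k := by
  obtain ⟨n, rfl⟩ : ∃ n, r = n + 2 := ⟨r - 2, by omega⟩
  set c := Finset.univ.gcd p with hc
  have hcp : ∀ i, c ∣ p i := fun i => Finset.gcd_dvd (mem_univ i)
  have hc0 : 0 < c := Nat.pos_of_dvd_of_pos (hcp 0) (hp 0)
  choose q hpq using hcp
  have hq : ∀ i, 0 < q i := fun i => Nat.pos_of_mul_pos_left (hpq i ▸ hp i)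
  have hsum : ∑ i, p i = c * ∑ i, q i := by simp only [hpq, mul_sum]
  have hweighted : ∀ g : Fin (n + 2) → ℕ, ∑ i, p i * g i = c * ∑ i, q i * g i := fun g => by
    simp only [hpq, mul_sum, mul_assoc]
  obtain ⟨g, hg, hgf⟩ := hγ.1.2 f hγf hcf
  obtain ⟨h, hh, hhf⟩ := hγ'.1.2 ((∑ i, p i) * k - f) (by omega)
    (Nat.dvd_sub (hsum ▸ (Dvd.intro _ rfl).mul_right k) hcf)
  have hk' : 2 * ∑ i, q i + (n + 1) ≤ k + 2 := by
    have hdiv : (4 * (∑ i, p i) - 2 * p 0 - 2 * p (Fin.last (n + 1))) / c =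
        4 * (∑ i, q i) - 2 * q 0 - 2 * q (Fin.last (n + 1)) := by
      rw [hsum, hpq 0, hpq (Fin.last (n + 1))]
      refine Nat.div_eq_of_eq_mul_right hc0 ?_
      simp only [Nat.mul_sub, mul_left_comm c]
    have hk₁ : (4 * (∑ i, p i) - 2 * p 0 - 2 * p (Fin.last (n + 1))) / c + 1 ≤ k + (n + 2) := hk
    have := sum_ge_first_add_last hq
    omega
  obtain ⟨g', hg', hsum', hle⟩ := exists_strictMono_last_le hq hg hh (k := k) (by
    refine Nat.eq_of_mul_eq_mul_left hc0 ?_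
    have hrev : ∑ i, p (Fin.rev i) * h i = c * ∑ i, q (Fin.rev i) * h i := by
      simp only [hpq, mul_sum, mul_assoc]
    rw [mul_add, ← hweighted, ← hrev, ← mul_assoc, ← hsum, hgf, hhf]
    omega) hk'
  exact ⟨g', ⟨hg', by rw [hweighted, hsum', ← hweighted, hgf]⟩, hle⟩
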